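/- Let i ∈ U with p_i < 1. Then for every data vector x, the conditional variance of the Horvitz–Thompson estimator given that i is not selected satisfies (1/(1−p_i))·Σ_{s : i ∉ s} p(s)·t̂(x,s)² − ((1/(1−p_i))·Σ_{s : i ∉ s} p(s)·t̂(x,s))² = Σ_{j,ℓ ∈ U∖{i}} (x_j x_ℓ/(p_j p_ℓ))·(p_{jℓ|−i} − p_{j|−i}·p_{ℓ|−i}), where p_{j|−i} = (p_j − p_{ij})/(1 − p_i) and p_{jℓ|−i} = (p_{jℓ} − p_{ijℓ})/(1 − p_i). In particular this quantity does not depend on x_i. -/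

import Mathlib

attribute [local instance] Classical.propDecidable

noncomputable section

/-- First-order inclusion probability `p_i = ∑_{s ∋ i} p(s)`. -/
def incl {U : Type*} [Fintype U] (p : Finset U → ℝ) (i : U) : ℝ :=
  ∑ s ∈ Finset.univ.filter (fun s : Finset U => i ∈ s), p s

/-- Second-order inclusion probability `p_{ij} = ∑_{s ⊇ {i,j}} p(s)`. -/
def incl2 {U : Type*} [Fintype U] (p : Finset U → ℝ) (i j : U) : ℝ :=
  ∑ s ∈ Finset.univ.filter (fun s : Finset U => i ∈ s ∧ j ∈ s), p s

/-- Third-order inclusion probability `p_{ijℓ} = ∑_{s ⊇ {i,j,ℓ}} p(s)`. -/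
def incl3 {U : Type*} [Fintype U] (p : Finset U → ℝ) (i j l : U) : ℝ :=
  ∑ s ∈ Finset.univ.filter (fun s : Finset U => i ∈ s ∧ j ∈ s ∧ l ∈ s), p s

/-- Horvitz–Thompson estimator `t̂(x,s) = ∑_{i ∈ s} x_i / p_i`. -/
def tHat {U : Type*} [Fintype U] (p : Finset U → ℝ) (x : U → ℝ) (s : Finset U) : ℝ :=
  ∑ i ∈ s, x i / incl p i

lemma aux_one {U : Type*} [Fintype U] (p : Finset U → ℝ) (i j : U) :
    incl p j - incl2 p i j =
      ∑ s ∈ Finset.univ.filter (fun s : Finset U => i ∉ s), p s * (if j ∈ s then 1 else 0) := by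
  unfold incl incl2
  simp only [Finset.sum_filter]
  rw [← Finset.sum_sub_distrib]
  refine Finset.sum_congr rfl fun s _ => ?_
  by_cases h1 : i ∈ s <;> by_cases h2 : j ∈ s <;> simp [h1, h2]

lemma aux_two {U : Type*} [Fintype U] (p : Finset U → ℝ) (i j l : U) :
    incl2 p j l - incl3 p i j l =
      ∑ s ∈ Finset.univ.filter (fun s : Finset U => i ∉ s),
        p s * ((if j ∈ s then 1 else 0) * (if l ∈ s then 1 else 0)) := by
  unfold incl2 incl3
  simp only [Finset.sum_filter]
  rw [← Finset.sum_sub_distrib]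
  refine Finset.sum_congr rfl fun s _ => ?_
  by_cases h1 : i ∈ s <;> by_cases h2 : j ∈ s <;> by_cases h3 : l ∈ s <;> simp [h1, h2, h3]

lemma aux_tHat {U : Type*} [Fintype U] (p : Finset U → ℝ) (x : U → ℝ) (i : U) (s : Finset U)
    (h : i ∉ s) :
    tHat p x s = ∑ j ∈ Finset.univ.erase i, x j / incl p j * (if j ∈ s then 1 else 0) := by
  unfold tHat
  simp only [mul_ite, mul_one, mul_zero]
  rw [← Finset.sum_filter]
  refine Finset.sum_congr ?_ fun _ _ => rfl
  ext j
  simp only [Finset.mem_filter, Finset.mem_erase, Finset.mem_univ, and_true]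
  constructor
  · intro hj
    exact ⟨fun e => h (e ▸ hj), hj⟩
  · exact fun hj => hj.2

lemma aux_m1 {U : Type*} [Fintype U] (p : Finset U → ℝ) (x : U → ℝ) (i : U) :
    ∑ s ∈ Finset.univ.filter (fun s : Finset U => i ∉ s), p s * tHat p x s =
      ∑ j ∈ Finset.univ.erase i, x j / incl p j * (incl p j - incl2 p i j) := by
  simp only [aux_one, Finset.mul_sum]
  rw [Finset.sum_comm]
  refine Finset.sum_congr rfl fun s hs => ?_
  rw [aux_tHat p x i s (Finset.mem_filter.1 hs).2, Finset.mul_sum]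
  exact Finset.sum_congr rfl fun j _ => by ring

lemma aux_m2 {U : Type*} [Fintype U] (p : Finset U → ℝ) (x : U → ℝ) (i : U) :
    ∑ s ∈ Finset.univ.filter (fun s : Finset U => i ∉ s), p s * tHat p x s ^ 2 =
      ∑ j ∈ Finset.univ.erase i, ∑ l ∈ Finset.univ.erase i,
        x j / incl p j * (x l / incl p l) * (incl2 p j l - incl3 p i j l) := by
  have h : ∀ s ∈ Finset.univ.filter (fun s : Finset U => i ∉ s), p s * tHat p x s ^ 2 =
      ∑ j ∈ Finset.univ.erase i, ∑ l ∈ Finset.univ.erase i,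
        x j / incl p j * (x l / incl p l) *
          (p s * ((if j ∈ s then 1 else 0) * (if l ∈ s then 1 else 0))) := by
    intro s hs
    rw [aux_tHat p x i s (Finset.mem_filter.1 hs).2, sq, Finset.sum_mul_sum, Finset.mul_sum]
    refine Finset.sum_congr rfl fun j _ => ?_
    rw [Finset.mul_sum]
    exact Finset.sum_congr rfl fun l _ => by ring
  rw [Finset.sum_congr rfl h, Finset.sum_comm]
  refine Finset.sum_congr rfl fun j _ => ?_
  rw [Finset.sum_comm]
  refine Finset.sum_congr rfl fun l _ => ?_
  rw [aux_two, Finset.mul_sum]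

/-- Conditional variance of the Horvitz–Thompson estimator given that unit `i` is
not selected:
`E[t̂² | i∉S] − E[t̂ | i∉S]² = ∑_{j,ℓ≠i} (x_j x_ℓ/(p_j p_ℓ))(p_{jℓ|−i} − p_{j|−i} p_{ℓ|−i})`,
with `p_{j|−i} = (p_j − p_{ij})/(1−p_i)` and `p_{jℓ|−i} = (p_{jℓ} − p_{ijℓ})/(1−p_i)`;
in particular this quantity does not depend on `x_i`. -/
theorem HT_cond_var_given_not_selected {U : Type*} [Fintype U]
    (p : Finset U → ℝ) (hp : ∀ s, 0 ≤ p s) (hsum : ∑ s : Finset U, p s = 1)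
    (hpos : ∀ j : U, 0 < incl p j) (i : U) (hlt : incl p i < 1) :
    (∀ x : U → ℝ,
      (1 - incl p i)⁻¹ * (∑ s ∈ Finset.univ.filter (fun s : Finset U => i ∉ s),
          p s * tHat p x s ^ 2) -
        ((1 - incl p i)⁻¹ * ∑ s ∈ Finset.univ.filter (fun s : Finset U => i ∉ s),
          p s * tHat p x s) ^ 2 =
      ∑ j ∈ Finset.univ.erase i, ∑ l ∈ Finset.univ.erase i,
        (x j * x l / (incl p j * incl p l)) *
          ((incl2 p j l - incl3 p i j l) / (1 - incl p i) -
            ((incl p j - incl2 p i j) / (1 - incl p i)) *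
              ((incl p l - incl2 p i l) / (1 - incl p i)))) ∧
    (∀ x x' : U → ℝ, (∀ j ≠ i, x j = x' j) →
      ∑ j ∈ Finset.univ.erase i, ∑ l ∈ Finset.univ.erase i,
        (x j * x l / (incl p j * incl p l)) *
          ((incl2 p j l - incl3 p i j l) / (1 - incl p i) -
            ((incl p j - incl2 p i j) / (1 - incl p i)) *
              ((incl p l - incl2 p i l) / (1 - incl p i))) =
      ∑ j ∈ Finset.univ.erase i, ∑ l ∈ Finset.univ.erase i,
        (x' j * x' l / (incl p j * incl p l)) *
          ((incl2 p j l - incl3 p i j l) / (1 - incl p i) -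
            ((incl p j - incl2 p i j) / (1 - incl p i)) *
              ((incl p l - incl2 p i l) / (1 - incl p i)))) := by
  constructor
  · intro x
    rw [aux_m1, aux_m2, mul_pow, sq (∑ j ∈ _, _), Finset.sum_mul_sum, Finset.mul_sum,
      Finset.mul_sum, ← Finset.sum_sub_distrib]
    refine Finset.sum_congr rfl fun j _ => ?_
    rw [Finset.mul_sum, Finset.mul_sum, ← Finset.sum_sub_distrib]
    refine Finset.sum_congr rfl fun l _ => ?_
    simp only [div_eq_mul_inv, mul_inv]
    ring
  · intro x x' h
    refine Finset.sum_congr rfl fun j hj => Finset.sum_congr rfl fun l hl => ?_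
    rw [h j (Finset.ne_of_mem_erase hj), h l (Finset.ne_of_mem_erase hl)]
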